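/- The Steiner triple system of order 15 with point set {∞} ∪ Z/7 ∪ Z/7' and blocks generated cyclically mod 7 by the base blocks {0,0',∞}, {0,1,3}, {0,1',6'}, {0,2',5'}, {0,3',4'} (the system STS(15) #61) has automorphism group isomorphic to the Frobenius group of order 21. -/

import Mathlib

/-- A Steiner triple system: every block has 3 points and every pair of
distinct points lies in exactly one block. -/
def IsSteiner {V : Type*} [DecidableEq V] (B : Finset (Finset V)) : Prop :=
  (∀ b ∈ B, b.card = 3) ∧
  ∀ x y : V, x ≠ y → ∃! b : Finset V, b ∈ B ∧ x ∈ b ∧ y ∈ b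

/-- A Fano plane: a Steiner triple system on a 7-point set. -/
def IsFano {V : Type*} [DecidableEq V] [Fintype V] (B : Finset (Finset V)) : Prop :=
  Fintype.card V = 7 ∧ IsSteiner B

/-- Two systems on the same point set are disjoint if they share no block. -/
def DisjointSTS {V : Type*} [DecidableEq V] (B1 B2 : Finset (Finset V)) : Prop :=
  ∀ b : Finset V, ¬ (b ∈ B1 ∧ b ∈ B2)

/-- Orthogonality of two Steiner triple systems: disjoint, and two distinct
pairs lying in blocks of the first system with a common third point never have
the same third point in the second system. -/
def OrthogonalSTS {V : Type*} [DecidableEq V] (B1 B2 : Finset (Finset V)) : Prop :=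
  DisjointSTS B1 B2 ∧
  ∀ x y z u v a b : V, ({x, y} : Finset V) ≠ ({u, v} : Finset V) →
    ({x, y, z} : Finset V) ∈ B1 → ({u, v, z} : Finset V) ∈ B1 →
    ({x, y, a} : Finset V) ∈ B2 → ({u, v, b} : Finset V) ∈ B2 → a ≠ b

/-- A permutation is an automorphism of a block set if it maps blocks to blocks. -/
def IsAutomorphism {V : Type*} [DecidableEq V] (B : Finset (Finset V)) (σ : Equiv.Perm V) : Prop :=
  ∀ b : Finset V, b.image σ ∈ B ↔ b ∈ B

/-- The group of all automorphisms of a block set, as a subgroup of the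
permutation group of the points. -/
def autGroup {V : Type*} [DecidableEq V] (B : Finset (Finset V)) : Subgroup (Equiv.Perm V) where
  carrier := {σ | IsAutomorphism B σ}
  one_mem' := by intro b; simp [Finset.image_id]
  mul_mem' := by
    intro σ τ hσ hτ
    intro b
    have h : Finset.image (⇑(σ * τ)) b = Finset.image ⇑σ (Finset.image ⇑τ b) := by
      rw [Finset.image_image]; rfl
    rw [h, hσ (Finset.image ⇑τ b), hτ b]
  inv_mem' := by
    intro σ hσ
    intro b
    have h : Finset.image ⇑σ (Finset.image ⇑σ⁻¹ b) = b := by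
      ext z
      simp
    have h2 := hσ (Finset.image ⇑σ⁻¹ b)
    rw [h] at h2
    exact h2.symm

/-- The permutation `x ↦ 2x` of `ZMod 7`. -/
def lam2 : Equiv.Perm (ZMod 7) :=
  ⟨fun x => 2 * x, fun x => 4 * x, by decide, by decide⟩

/-- The permutation `x ↦ x + 1` of `ZMod 7`. -/
def tau1 : Equiv.Perm (ZMod 7) :=
  ⟨fun x => x + 1, fun x => x - 1, by decide, by decide⟩

/-- The Frobenius group of order 21, realized as the subgroup of `Perm (ZMod 7)`
generated by `x ↦ 2x` and `x ↦ x + 1`. -/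
def F21 : Subgroup (Equiv.Perm (ZMod 7)) := Subgroup.closure {lam2, tau1}

/-- The 15-point set `{∞} ∪ Z/7 ∪ (Z/7)'`. -/
inductive P15 where
  | inf : P15
  | pt : ZMod 7 → P15
  | pt' : ZMod 7 → P15
  deriving DecidableEq, Fintype

/-- The cyclic translation by `i`: fixes `∞`, maps `n ↦ n + i` and `n' ↦ (n + i)'`. -/
def shift15 (i : ZMod 7) : P15 → P15
  | P15.inf => P15.inf
  | P15.pt n => P15.pt (n + i)
  | P15.pt' n => P15.pt' (n + i)

/-- The base blocks `{0,0',∞}, {0,1,3}, {0,1',6'}, {0,2',5'}, {0,3',4'}`. -/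
def baseBlocks61 : Finset (Finset P15) :=
  { {P15.pt 0, P15.pt' 0, P15.inf},
    {P15.pt 0, P15.pt 1, P15.pt 3},
    {P15.pt 0, P15.pt' 1, P15.pt' 6},
    {P15.pt 0, P15.pt' 2, P15.pt' 5},
    {P15.pt 0, P15.pt' 3, P15.pt' 4} }

/-- The 35 blocks of the Steiner triple system STS(15) #61, generated
cyclically mod 7 from the base blocks. -/
def blocks61 : Finset (Finset P15) :=
  Finset.univ.biUnion (fun i : ZMod 7 => baseBlocks61.image (Finset.image (shift15 i)))

/-- The Steiner quasigroup of the system: `third x y` completes `x ≠ y` to a block, and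
`third x x = x`. -/
def third : P15 → P15 → P15
  | .inf, .inf => .inf
  | .inf, .pt i => .pt' i
  | .inf, .pt' i => .pt i
  | .pt i, .inf => .pt' i
  | .pt' i, .inf => .pt i
  | .pt i, .pt j => .pt (i + 4 * (j - i) - (j - i) ^ 4)
  | .pt i, .pt' j => if i = j then .inf else .pt' (2 * i - j)
  | .pt' j, .pt i => if i = j then .inf else .pt' (2 * i - j)
  | .pt' i, .pt' j => if i = j then .pt' i else .pt (4 * (i + j))

theorem third_self (x : P15) : third x x = x := by
  revert x; decide

theorem mem_blocks61_third {x y : P15} (h : x ≠ y) : {x, y, third x y} ∈ blocks61 := by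
  revert x y; decide +kernel

theorem third_shift15 (i : ZMod 7) (x y : P15) :
    third (shift15 i x) (shift15 i y) = shift15 i (third x y) := by
  revert i x y; decide +kernel

theorem eq_third_of_mem_baseBlocks61 : ∀ b ∈ baseBlocks61, ∀ x ∈ b, ∀ y ∈ b, ∀ z ∈ b,
    x ≠ y → z ≠ x → z ≠ y → z = third x y := by
  intro b hb
  simp only [baseBlocks61, Finset.mem_insert, Finset.mem_singleton] at hb
  rcases hb with rfl | rfl | rfl | rfl | rfl <;> decide +kernel

theorem eq_third_of_mem_blocks61 {x y z : P15} (hb : {x, y, z} ∈ blocks61)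
    (hxy : x ≠ y) (hzx : z ≠ x) (hzy : z ≠ y) : z = third x y := by
  simp only [blocks61, Finset.mem_biUnion, Finset.mem_univ, true_and, Finset.mem_image] at hb
  obtain ⟨i, b, hb, h⟩ := hb
  have preimage {w : P15} (hw : w ∈ ({x, y, z} : Finset P15)) : ∃ v ∈ b, shift15 i v = w := by
    rwa [← h, Finset.mem_image] at hw
  obtain ⟨x, hx, rfl⟩ := preimage (w := x) (by simp)
  obtain ⟨y, hy, rfl⟩ := preimage (w := y) (by simp)
  obtain ⟨z, hz, rfl⟩ := preimage (w := z) (by simp)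
  rw [third_shift15, ← eq_third_of_mem_baseBlocks61 b hb x hx y hy z hz (ne_of_apply_ne _ hxy)
    (ne_of_apply_ne _ hzx) (ne_of_apply_ne _ hzy)]

theorem third_ne {x y : P15} (h : x ≠ y) : third x y ≠ x ∧ third x y ≠ y := by
  revert x y; decide

theorem IsAutomorphism.map_third {σ : Equiv.Perm P15} (hσ : IsAutomorphism blocks61 σ)
    (x y : P15) : σ (third x y) = third (σ x) (σ y) := by
  rcases eq_or_ne x y with rfl | h
  · simp only [third_self]
  · have hb := (hσ _).2 (mem_blocks61_third h)
    simp only [Finset.image_insert, Finset.image_singleton] at hb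
    exact eq_third_of_mem_blocks61 hb (σ.injective.ne h) (σ.injective.ne (third_ne h).1)
      (σ.injective.ne (third_ne h).2)

/-- The point `∞` is the only one lying in no Pasch configuration. -/
theorem eq_inf_iff (x : P15) :
    x = .inf ↔ ∀ y z, third y z = third (third x y) (third x z) → z = third x y := by
  revert x; decide +kernel

/-- The points `pt i` are those lying in a Fano subplane. -/
theorem exists_eq_pt_iff (x : P15) :
    (∃ i, x = .pt i) ↔ ∃ y z, z ≠ x ∧ third (third x y) z = third x (third y z) ∧
      third (third x y) z = third y (third x z) := by
  revert x; decide +kernel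

/-- A permutation of `Z/7` acting simultaneously on both copies of `Z/7` and fixing `∞`. -/
def liftPerm : Equiv.Perm (ZMod 7) →* Equiv.Perm P15 where
  toFun s :=
    { toFun := fun
        | .inf => .inf
        | .pt i => .pt (s i)
        | .pt' i => .pt' (s i)
      invFun := fun
        | .inf => .inf
        | .pt i => .pt (s.symm i)
        | .pt' i => .pt' (s.symm i)
      left_inv := by rintro (_ | _ | _) <;> simp
      right_inv := by rintro (_ | _ | _) <;> simp }
  map_one' := by ext (_ | _ | _) <;> rfl
  map_mul' s t := by ext (_ | _ | _) <;> rfl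

theorem liftPerm_injective : Function.Injective liftPerm := by
  intro s t h
  ext1 i
  exact P15.pt.inj (DFunLike.congr_fun h (.pt i))

theorem isAutomorphism_of_image_eq {V : Type*} [DecidableEq V] {B : Finset (Finset V)}
    {σ : Equiv.Perm V} (h : B.image (Finset.image σ) = B) : IsAutomorphism B σ := by
  intro b
  conv_lhs => rw [← h]
  exact (Finset.image_injective σ.injective).mem_finset_image

theorem map_liftPerm_F21_le : F21.map liftPerm ≤ autGroup blocks61 := by
  rw [Subgroup.map_le_iff_le_comap, F21, Subgroup.closure_le]
  rintro _ (rfl | rfl)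
  · exact isAutomorphism_of_image_eq (by decide +kernel)
  · exact isAutomorphism_of_image_eq (by decide +kernel)

theorem mem_F21_of_affine {s : Equiv.Perm (ZMod 7)} {a b : ZMod 7} (ha : a ≠ 0)
    (ha' : a ^ 4 = a) (hs : ∀ i, s i = a * i + b) : s ∈ F21 := by
  have key : ∀ a b : ZMod 7, a ≠ 0 → a ^ 4 = a →
      ∃ k : Fin 3, ∀ i, (tau1 ^ b.val * lam2 ^ k.val) i = a * i + b := by
    decide +kernel
  obtain ⟨k, hk⟩ := key a b ha ha'
  have : s = tau1 ^ b.val * lam2 ^ k.val := Equiv.ext fun i => (hs i).trans (hk i).symm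
  rw [this]
  exact mul_mem (pow_mem (Subgroup.subset_closure (by simp)) _)
    (pow_mem (Subgroup.subset_closure (by simp)) _)

theorem IsAutomorphism.map_inf {σ : Equiv.Perm P15} (hσ : IsAutomorphism blocks61 σ) :
    σ .inf = .inf := by
  refine (eq_inf_iff _).2 (σ.surjective.forall₂.2 fun y z h => ?_)
  simp only [← hσ.map_third] at h ⊢
  exact congrArg σ ((eq_inf_iff .inf).1 rfl y z (σ.injective h))

theorem IsAutomorphism.exists_map_pt {σ : Equiv.Perm P15} (hσ : IsAutomorphism blocks61 σ)
    (i : ZMod 7) : ∃ j, σ (.pt i) = .pt j := by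
  obtain ⟨y, z, hz, h₁, h₂⟩ := (exists_eq_pt_iff (.pt i)).1 ⟨i, rfl⟩
  refine (exists_eq_pt_iff _).2 ⟨σ y, σ z, σ.injective.ne hz, ?_, ?_⟩
  · simpa only [hσ.map_third] using congrArg σ h₁
  · simpa only [hσ.map_third] using congrArg σ h₂

theorem eq_affine_of_midpoint {s : ZMod 7 → ZMod 7}
    (h : ∀ i, s (i + 1) = 2 * s i - s (i - 1)) (i : ZMod 7) :
    s i = (s 1 - s 0) * i + s 0 := by
  have h2 : s 2 = 2 * s 1 - s 0 := h 1
  have h3 : s 3 = 2 * s 2 - s 1 := h 2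
  have h4 : s 4 = 2 * s 3 - s 2 := h 3
  have h5 : s 5 = 2 * s 4 - s 3 := h 4
  have h6 : s 6 = 2 * s 5 - s 4 := h 5
  rw [h2] at h3
  rw [h3, h2] at h4
  rw [h4, h3] at h5
  rw [h5, h4] at h6
  have hi : i = 0 ∨ i = 1 ∨ i = 2 ∨ i = 3 ∨ i = 4 ∨ i = 5 ∨ i = 6 := by revert i; decide
  rcases hi with rfl | rfl | rfl | rfl | rfl | rfl | rfl
  · ring
  · ring
  · rw [h2]; ring
  · rw [h3]; ring
  · rw [h4]; ring
  · rw [h5]; ring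
  · rw [h6]; ring

theorem autGroup_le_map_liftPerm_F21 : autGroup blocks61 ≤ F21.map liftPerm := by
  intro σ (hσ : IsAutomorphism blocks61 σ)
  choose s hs using hσ.exists_map_pt
  have hs' (i) : σ (.pt' i) = .pt' (s i) := by
    have := hσ.map_third .inf (.pt i)
    rwa [hσ.map_inf, hs] at this
  have hinj : Function.Injective s := by
    intro i j h
    exact P15.pt.inj (σ.injective (by rw [hs, hs, h]))
  have hmid (i) : s (i + 1) = 2 * s i - s (i - 1) := by
    have hne : i ≠ i - 1 := by revert i; decide
    have h := hσ.map_third (.pt i) (.pt' (i - 1))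
    rw [hs, hs', third, third, if_neg hne, if_neg (hinj.ne hne), hs'] at h
    rw [← P15.pt'.inj h]
    ring_nf
  have haff := eq_affine_of_midpoint hmid
  have hfano : s 3 = s 0 + 4 * (s 1 - s 0) - (s 1 - s 0) ^ 4 := by
    have h := hσ.map_third (.pt 0) (.pt 1)
    rw [hs, hs] at h
    exact P15.pt.inj ((hs 3).symm.trans h)
  refine ⟨Equiv.ofBijective s (Finite.injective_iff_bijective.1 hinj),
    mem_F21_of_affine (sub_ne_zero.2 (hinj.ne (by decide))) ?_ haff, ?_⟩
  · linear_combination hfano - haff 3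
  · ext (_ | i | i)
    · exact hσ.map_inf.symm
    · exact (hs i).symm
    · exact (hs' i).symm

/-- The automorphism group of the Steiner triple system STS(15) #61 is
isomorphic to the Frobenius group of order 21. -/
theorem sts61_autGroup_iso_F21 :
    Nonempty ((autGroup blocks61 : Subgroup (Equiv.Perm P15)) ≃* F21) := by
  rw [autGroup_le_map_liftPerm_F21.antisymm map_liftPerm_F21_le]
  exact ⟨(F21.equivMapOfInjective liftPerm liftPerm_injective).symm⟩
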